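/- Let n ≥ 1 and 1 ≤ ℓ₁ ≤ … ≤ ℓ_r ≤ n, and let T = C_r ⊗ … ⊗ C₁ with C_i ∈ B(ϖ_{ℓ_i}). If T is not semistandard (i.e. C_{k+1} ⊗ C_k fails to be semistandard for some k), then Ψ_T = 0 in the finite Hecke algebra H_n. -/

import Mathlib

set_option maxHeartbeats 1000000

attribute [local instance] Classical.propDecidable

noncomputable section

namespace HLHecke

/-- The base ring `ℤ[t^{±1}]` of Laurent polynomials. -/
abbrev HR : Type := LaurentPolynomial ℤ

/-- The parameter `t`. -/
def tt : HR := LaurentPolynomial.T 1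

/-! ### The symmetric group on `Fin n` -/

/-- The simple transposition `s_j = (j, j+1)` (junk value `1` if out of range). -/
def sgen (n : ℕ) (j : ℕ) : Equiv.Perm (Fin n) :=
  if h : j + 1 < n then Equiv.swap ⟨j, Nat.lt_of_succ_lt h⟩ ⟨j + 1, h⟩ else 1

/-- The product `s_{i₁} ⋯ s_{i_ℓ}` of a word `l = [i₁, …, i_ℓ]`. -/
def wordProd (n : ℕ) (l : List ℕ) : Equiv.Perm (Fin n) := (l.map (sgen n)).prod

/-- The action of `S_n` on `ℤⁿ` by permutation of coordinates. -/
def wAct (n : ℕ) (w : Equiv.Perm (Fin n)) (μ : Fin n → ℤ) : Fin n → ℤ := fun i => μ (w⁻¹ i)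

/-- The standard inner product on `ℤⁿ`. -/
def ip (n : ℕ) (μ ν : Fin n → ℤ) : ℤ := ∑ i, μ i * ν i

/-- The standard basis vector `ε_i`. -/
def eps (n : ℕ) (i : Fin n) : Fin n → ℤ := fun k => if k = i then 1 else 0

/-- The simple root `α_j = ε_j − ε_{j+1}` (0-indexed: entries `j` and `j+1` of `Fin n`). -/
def alpha (n : ℕ) (j : ℕ) : Fin n → ℤ :=
  fun i => if (i : ℕ) = j then 1 else if (i : ℕ) = j + 1 then -1 else 0

/-- The fundamental weight `ϖ_k = ε₁ + … + ε_k`. -/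
def varpi (n : ℕ) (k : ℕ) : Fin n → ℤ := fun i => if (i : ℕ) < k then 1 else 0

/-- The set of positive roots `R₊`. -/
def Rpos (n : ℕ) (β : Fin n → ℤ) : Prop := ∃ i j : Fin n, i < j ∧ β = eps n i - eps n j

/-- The Coxeter length: minimal length of a word in the simple transpositions. -/
def len (n : ℕ) (w : Equiv.Perm (Fin n)) : ℕ :=
  sInf {k | ∃ l : List ℕ, (∀ j ∈ l, j + 1 < n) ∧ l.length = k ∧ wordProd n l = w}

/-- A choice of reduced word for `w`. -/
def redWord (n : ℕ) (w : Equiv.Perm (Fin n)) : List ℕ :=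
  if h : ∃ l : List ℕ, (∀ j ∈ l, j + 1 < n) ∧ l.length = len n w ∧ wordProd n l = w
  then h.choose else []

/-! ### Columns -/

lemma col_card_le (n : ℕ) (C : Finset (Fin n)) : C.card ≤ n := by
  simpa using Finset.card_le_univ C

/-- The minimal length coset representative `u_C` attached to a column `C`:
it sends `1, …, ℓ` to the entries of `C` in increasing order and `ℓ+1, …, n` to the
entries of the complement of `C` in increasing order. -/
def colPerm (n : ℕ) (C : Finset (Fin n)) : Equiv.Perm (Fin n) :=
  ((finCongr ((Nat.add_sub_cancel' (col_card_le n C)).symm)).trans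
    finSumFinEquiv.symm).trans <|
  ((Equiv.sumCongr (C.orderIsoOfFin rfl).toEquiv
      ((Cᶜ.orderIsoOfFin (by simp [Finset.card_compl])).toEquiv)).trans <|
    (Equiv.sumCongr (Equiv.refl _) (Equiv.subtypeEquivRight (fun x => Finset.mem_compl))).trans
      (Equiv.sumCompl (fun x => x ∈ C)))

/-- The `k`-th smallest entry of a column (0-indexed, as a natural number; junk `0` if
out of range). -/
def nth (n : ℕ) (C : Finset (Fin n)) (k : ℕ) : ℕ := ((C.sort (· ≤ ·)).map Fin.val).getD k 0

/-- The action of the simple transposition `s_j` on columns. -/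
def sCol (n : ℕ) (j : ℕ) (C : Finset (Fin n)) : Finset (Fin n) := C.image (sgen n j)

/-- Semistandardness of the two-column filling `F ⊗ E` (`F` the left column):
entrywise `f_i ≤ e_i`. -/
def pairSS (n : ℕ) (F E : Finset (Fin n)) : Prop := ∀ k < E.card, nth n F k ≤ nth n E k

/-- A filling by columns (leftmost column first) is semistandard iff all adjacent pairs are. -/
def isSSYT (n : ℕ) (L : List (Finset (Fin n))) : Prop := L.Chain' (pairSS n)

/-- The set `B(ϖ_ℓ)` of columns of length `ℓ`. -/
def colFinset (n : ℕ) (ℓ : ℕ) : Finset (Finset (Fin n)) := Finset.univ.filter fun C => C.card = ℓ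

/-- The highest weight column `(1, …, k)`. -/
def hwCol (n : ℕ) (k : ℕ) : Finset (Fin n) := Finset.univ.filter fun x => (x : ℕ) < k

/-- The vector `⃗C ∈ ℤⁿ` attached to a column `C`. -/
def vecOf (n : ℕ) (C : Finset (Fin n)) : Fin n → ℤ := fun i => if i ∈ C then 1 else 0

/-- The sign `σ^j_C`: `-1` if `j ∈ C` and `j+1 ∉ C`, and `+1` otherwise. -/
def sigmaSign (n : ℕ) (j : ℕ) (C : Finset (Fin n)) : ℤ :=
  if h : j + 1 < n then
    (if (⟨j, Nat.lt_of_succ_lt h⟩ : Fin n) ∈ C ∧ (⟨j + 1, h⟩ : Fin n) ∉ C then -1 else 1)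
  else 1

/-! ### Shapes and tableaux -/

/-- The length `λ'_{j+1}` of the `(j+1)`-st column (0-indexed `j`) of the Young diagram
of a partition `λ`. -/
def shapeColLen (n : ℕ) (μ : Fin n → ℤ) (j : ℕ) : ℕ :=
  (Finset.univ.filter fun i : Fin n => (j : ℤ) < μ i).card

/-- The number of columns of the Young diagram of a dominant weight. -/
def numCols (n : ℕ) (μ : Fin n → ℤ) : ℕ := Finset.univ.sup fun i : Fin n => (μ i).toNat

/-- The highest weight tableau `T⁰_μ`: row `i` is filled with `i`, i.e. its columns are the
highest weight columns. -/
def hwTableau (n : ℕ) (μ : Fin n → ℤ) : List (Finset (Fin n)) :=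
  List.ofFn fun j : Fin (numCols n μ) => hwCol n (shapeColLen n μ (j : ℕ))

/-- The content vector of a tableau: `(wtVec T) i` is the number of entries equal to `i`. -/
def wtVec (n : ℕ) (L : List (Finset (Fin n))) : Fin n → ℤ :=
  fun i => ((L.filter fun C => i ∈ C).length : ℤ)

/-! ### Macdonald's ψ statistic -/

/-- Number of entries `≤ i` in the column at position `p` (0-indexed from the left). -/
def colCount (n : ℕ) (L : List (Finset (Fin n))) (i p : ℕ) : ℕ :=
  ((L.getD p ∅).filter fun x => (x : ℕ) < i).card

/-- The factor `ψ_{T_{≤ i+1}/T_{≤ i}}` of Macdonald's ψ. -/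
def stripFactor (n : ℕ) (L : List (Finset (Fin n))) (i : ℕ) : HR :=
  ∏ p ∈ Finset.range L.length,
    if colCount n L (i + 1) p = colCount n L i p ∧
        colCount n L (i + 1) (p + 1) = colCount n L i (p + 1) + 1 then
      1 - tt ^ (colCount n L i p - colCount n L i (p + 1))
    else 1

/-- Macdonald's `ψ_T = ∏_{i=1}^{n-1} ψ_{T_{≤ i+1}/T_{≤ i}}` for a semistandard tableau. -/
def macPsi (n : ℕ) (L : List (Finset (Fin n))) : HR := ∏ i ∈ Finset.Ico 1 n, stripFactor n L i

/-- Macdonald's tableau statistic, extended by `0` to non-semistandard fillings. -/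
def psiT (n : ℕ) (L : List (Finset (Fin n))) : HR := if isSSYT n L then macPsi n L else 0

/-! ### The affine Hecke algebra -/

/-- Generators of the affine Hecke algebra. -/
inductive AGen (n : ℕ) : Type
  | T : ℕ → AGen n
  | X : Fin n → AGen n
  | Xinv : Fin n → AGen n

/-- The free algebra on the generators. -/
abbrev FA (n : ℕ) := FreeAlgebra HR (AGen n)

def fT (n : ℕ) (j : ℕ) : FA n := FreeAlgebra.ι HR (AGen.T j)
def fX (n : ℕ) (i : Fin n) : FA n := FreeAlgebra.ι HR (AGen.X i)
def fXi (n : ℕ) (i : Fin n) : FA n := FreeAlgebra.ι HR (AGen.Xinv i)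

/-- The defining relations of the type `GL_n` affine Hecke algebra. -/
inductive ARel (n : ℕ) : FA n → FA n → Prop
  | junk (j : ℕ) (h : ¬ j + 1 < n) : ARel n (fT n j) 1
  | quad (j : ℕ) (h : j + 1 < n) :
      ARel n (fT n j * fT n j) ((tt - 1) • fT n j + algebraMap HR (FA n) tt)
  | braid (j : ℕ) (h : j + 2 < n) :
      ARel n (fT n j * fT n (j + 1) * fT n j) (fT n (j + 1) * fT n j * fT n (j + 1))
  | commT (j k : ℕ) (hjk : j + 1 < k) (hk : k + 1 < n) :
      ARel n (fT n j * fT n k) (fT n k * fT n j)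
  | commX (i i' : Fin n) : ARel n (fX n i * fX n i') (fX n i' * fX n i)
  | XinvL (i : Fin n) : ARel n (fX n i * fXi n i) 1
  | XinvR (i : Fin n) : ARel n (fXi n i * fX n i) 1
  | TXT (j : ℕ) (h : j + 1 < n) :
      ARel n (fT n j * fX n ⟨j, Nat.lt_of_succ_lt h⟩ * fT n j) (tt • fX n ⟨j + 1, h⟩)
  | TXcomm (j : ℕ) (h : j + 1 < n) (i : Fin n) (hi1 : (i : ℕ) ≠ j) (hi2 : (i : ℕ) ≠ j + 1) :
      ARel n (fT n j * fX n i) (fX n i * fT n j)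

/-- The type `GL_n` affine Hecke algebra. -/
abbrev H (n : ℕ) := RingQuot (ARel n)

/-- The generator `T_j` of the (affine) Hecke algebra. -/
def Tg (n : ℕ) (j : ℕ) : H n := RingQuot.mkAlgHom HR (ARel n) (fT n j)

/-- The generator `X_i`. -/
def Xg (n : ℕ) (i : Fin n) : H n := RingQuot.mkAlgHom HR (ARel n) (fX n i)

/-- The generator `X_i⁻¹`. -/
def Xig (n : ℕ) (i : Fin n) : H n := RingQuot.mkAlgHom HR (ARel n) (fXi n i)

/-- The scalar `t` inside `H`. -/
def tH (n : ℕ) : H n := algebraMap HR (H n) tt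

/-- The scalar `t^k` inside `H`. -/
def tpow (n : ℕ) (k : ℕ) : H n := algebraMap HR (H n) (tt ^ k)

/-- The monomial `X^μ` for `μ ∈ ℤⁿ`. -/
def Xmon (n : ℕ) (μ : Fin n → ℤ) : H n :=
  (List.ofFn fun i : Fin n =>
    if 0 ≤ μ i then Xg n i ^ (μ i).toNat else Xig n i ^ (-μ i).toNat).prod

/-- The product `T_{i₁} ⋯ T_{i_ℓ}` of a word. -/
def TofWord (n : ℕ) (l : List ℕ) : H n := (l.map (Tg n)).prod

/-- The element `T_w`, defined via a choice of reduced word for `w`. -/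
def Tw (n : ℕ) (w : Equiv.Perm (Fin n)) : H n := TofWord n (redWord n w)

/-- The finite Hecke symmetrizer `1₀ = Σ_{w ∈ S_n} T_w`. -/
def one0 (n : ℕ) : H n := ∑ w : Equiv.Perm (Fin n), Tw n w

/-- The stabilizer `S_{n,λ}` as a finset. -/
def stabFinset (n : ℕ) (lam : Fin n → ℤ) : Finset (Equiv.Perm (Fin n)) :=
  Finset.univ.filter fun w => wAct n w lam = lam

/-- The parabolic symmetrizer `1_λ = Σ_{w ∈ S_{n,λ}} T_w`. -/
def onePara (n : ℕ) (lam : Fin n → ℤ) : H n := ∑ w ∈ stabFinset n lam, Tw n w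

/-- The Poincaré polynomial `W_λ(t) = Σ_{w ∈ S_{n,λ}} t^{ℓ(w)}`. -/
def Wlam (n : ℕ) (lam : Fin n → ℤ) : HR := ∑ w ∈ stabFinset n lam, tt ^ len n w

/-- The parabolic subalgebra `H_{n,λ}`, as the span of `{T_w : w ∈ S_{n,λ}}`. -/
def HparaM (n : ℕ) (lam : Fin n → ℤ) : Submodule HR (H n) :=
  Submodule.span HR (Tw n '' {w | wAct n w lam = lam})

/-- The finite Hecke algebra `H_n`, the subalgebra generated by the `T_j`. -/
def Hfin (n : ℕ) : Subalgebra HR (H n) := Algebra.adjoin HR (Set.range (Tg n))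

/-- The coefficient `h_{C, S}` of the parabolic decomposition
`h = Σ_{F ∈ B(ϖ_ℓ)} T_{u_F} h_F` (defined via choice; it is unique). -/
def paraCoeff (n : ℕ) (ℓ : ℕ) (h : H n) (C : Finset (Fin n)) : H n :=
  if hex : ∃ g : Finset (Fin n) → H n,
      (∀ F : Finset (Fin n), F.card = ℓ → g F ∈ HparaM n (varpi n ℓ)) ∧
      h = ∑ F ∈ colFinset n ℓ, Tw n (colPerm n F) * g F
  then hex.choose C else 0

/-- The elements `Ψ_T` of the finite Hecke algebra, defined by recursion on the columns of `T`
(leftmost column first).  By convention `Ψ` of the empty tableau is `1₀`. -/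
def Psi (n : ℕ) : List (Finset (Fin n)) → H n
  | [] => one0 n
  | [C] => tpow n (len n (colPerm n C)) * Ring.inverse (Tw n (colPerm n C)⁻¹) *
      onePara n (varpi n C.card)
  | C :: S => tpow n (len n (colPerm n C)) * Ring.inverse (Tw n (colPerm n C)⁻¹) *
      paraCoeff n C.card (Psi n S) C

end HLHecke
namespace HLHecke


def ti : HR := LaurentPolynomial.T (-1)
lemma tt_ti : tt * ti = 1 := by
  rw [tt, ti, ← LaurentPolynomial.T_add]; exact LaurentPolynomial.T_zero
lemma ti_tt : ti * tt = 1 := by rw [mul_comm, tt_ti]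

lemma sgen_of {n j : ℕ} (h : j + 1 < n) :
    sgen n j = Equiv.swap ⟨j, Nat.lt_of_succ_lt h⟩ ⟨j + 1, h⟩ := by simp [sgen, h]

lemma sgen_val {n j : ℕ} (h : j + 1 < n) (x : Fin n) : (sgen n j x : ℕ) =
    if (x : ℕ) = j then j + 1 else if (x : ℕ) = j + 1 then j else x := by
  rw [sgen_of h, Equiv.swap_apply_def]
  simp only [Fin.ext_iff]
  split_ifs <;> rfl

lemma sgen_inv (n j : ℕ) : (sgen n j)⁻¹ = sgen n j := by
  unfold sgen; split_ifs <;> simp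

lemma sgen_sq (n j : ℕ) : sgen n j * sgen n j = 1 := by
  unfold sgen; split_ifs <;> simp

lemma sgen_sq' (n j : ℕ) (w : Equiv.Perm (Fin n)) : sgen n j * (sgen n j * w) = w := by
  rw [← mul_assoc, sgen_sq, one_mul]

lemma sgen_braid {n j : ℕ} (h : j + 2 < n) (w : Equiv.Perm (Fin n)) :
    sgen n (j+1) * (sgen n j * (sgen n (j+1) * w)) = sgen n j * (sgen n (j+1) * (sgen n j * w)) := by
  ext x
  have h1 : j + 1 < n := by omega
  have h2 : j + 1 + 1 < n := by omega
  simp only [Equiv.Perm.mul_apply, sgen_val h1, sgen_val h2]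
  generalize (w x : ℕ) = y
  split_ifs <;> omega

lemma sgen_comm {n j k : ℕ} (hjk : j + 1 < k) (h : k + 1 < n) (w : Equiv.Perm (Fin n)) :
    sgen n k * (sgen n j * w) = sgen n j * (sgen n k * w) := by
  ext x
  have h1 : j + 1 < n := by omega
  have h2 := h
  simp only [Equiv.Perm.mul_apply, sgen_val h1, sgen_val h2]
  generalize (w x : ℕ) = y
  split_ifs <;> omega

abbrev MM (n : ℕ) := Equiv.Perm (Fin n) → HR

def TopH (n j : ℕ) (h : j + 1 < n) : Module.End HR (MM n) where
  toFun f w := if w⁻¹ ⟨j, Nat.lt_of_succ_lt h⟩ < w⁻¹ ⟨j+1, h⟩ then tt * f (sgen n j * w)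
    else (tt - 1) * f w + f (sgen n j * w)
  map_add' f g := by ext1 w; simp only [Pi.add_apply]; split_ifs <;> ring
  map_smul' c f := by ext1 w; simp only [Pi.smul_apply, smul_eq_mul, RingHom.id_apply]; split_ifs <;> ring

def Top (n j : ℕ) : Module.End HR (MM n) := if h : j + 1 < n then TopH n j h else 1

lemma Top_apply {n j : ℕ} (h : j + 1 < n) (f : MM n) (w) : Top n j f w =
    if w⁻¹ ⟨j, Nat.lt_of_succ_lt h⟩ < w⁻¹ ⟨j+1, h⟩ then tt * f (sgen n j * w)
    else (tt - 1) * f w + f (sgen n j * w) := by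
  simp [Top, h, TopH]

lemma Top_quad {n j : ℕ} (h : j + 1 < n) :
    Top n j * Top n j = (tt - 1) • Top n j + algebraMap HR _ tt := by
  refine LinearMap.ext fun f => funext fun w => ?_
  have e : w⁻¹ ⟨j, Nat.lt_of_succ_lt h⟩ ≠ w⁻¹ ⟨j+1, h⟩ := by simp
  simp only [Module.End.mul_apply, LinearMap.add_apply, LinearMap.smul_apply, Pi.add_apply,
    Pi.smul_apply, Module.algebraMap_end_apply, Top_apply h, mul_inv_rev, sgen_inv,
    Equiv.Perm.mul_apply, sgen_sq', smul_eq_mul]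
  rw [sgen_of h]
  simp only [Equiv.swap_apply_left, Equiv.swap_apply_right]
  rcases lt_or_gt_of_ne e with h1 | h1 <;> simp only [h1, not_lt_of_gt h1, if_true, if_false] <;> ring

lemma Top_braid {n j : ℕ} (h : j + 2 < n) :
    Top n j * Top n (j+1) * Top n j = Top n (j+1) * Top n j * Top n (j+1) := by
  refine LinearMap.ext fun f => funext fun w => ?_
  have h0 : j + 1 < n := by omega
  have e1 : w⁻¹ ⟨j, by omega⟩ ≠ w⁻¹ ⟨j+1, by omega⟩ := by simp
  have e2 : w⁻¹ ⟨j, by omega⟩ ≠ w⁻¹ ⟨j+2, by omega⟩ := by simp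
  have e3 : w⁻¹ ⟨j+1, by omega⟩ ≠ w⁻¹ ⟨j+2, by omega⟩ := by simp
  simp only [Module.End.mul_apply, Top_apply h, Top_apply h0, mul_inv_rev, sgen_inv,
    Equiv.Perm.mul_apply, sgen_sq', sgen_braid h]
  have s1 : sgen n j ⟨j, by omega⟩ = ⟨j+1, by omega⟩ := by rw [sgen_of h0]; simp
  have s2 : sgen n j ⟨j+1, by omega⟩ = ⟨j, by omega⟩ := by rw [sgen_of h0]; simp
  have s3 : sgen n j ⟨j+2, by omega⟩ = ⟨j+2, by omega⟩ := by
    rw [sgen_of h0]; apply Equiv.swap_apply_of_ne_of_ne <;> simp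
  have s4 : sgen n (j+1) ⟨j, by omega⟩ = ⟨j, by omega⟩ := by
    rw [sgen_of h]; apply Equiv.swap_apply_of_ne_of_ne <;> simp <;> omega
  have s5 : sgen n (j+1) ⟨j+1, by omega⟩ = ⟨j+2, by omega⟩ := by rw [sgen_of h]; simp
  have s6 : sgen n (j+1) ⟨j+2, by omega⟩ = ⟨j+1, by omega⟩ := by rw [sgen_of h]; simp
  simp only [s1, s2, s3, s4, s5, s6, show j+1+1 = j+2 from rfl]
  generalize w⁻¹ ⟨j, by omega⟩ = x at *
  generalize w⁻¹ ⟨j+1, by omega⟩ = y at *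
  generalize w⁻¹ ⟨j+2, by omega⟩ = z at *
  split_ifs <;> first | ring1 | (exfalso; omega)

lemma Top_comm {n j k : ℕ} (hjk : j + 1 < k) (h : k + 1 < n) :
    Top n j * Top n k = Top n k * Top n j := by
  refine LinearMap.ext fun f => funext fun w => ?_
  have h0 : j + 1 < n := by omega
  simp only [Module.End.mul_apply, Top_apply h, Top_apply h0, mul_inv_rev, sgen_inv,
    Equiv.Perm.mul_apply, sgen_comm hjk h]
  have s1 : sgen n k ⟨j, by omega⟩ = ⟨j, by omega⟩ := by
    rw [sgen_of h]; apply Equiv.swap_apply_of_ne_of_ne <;> simp <;> omega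
  have s2 : sgen n k ⟨j+1, by omega⟩ = ⟨j+1, by omega⟩ := by
    rw [sgen_of h]; apply Equiv.swap_apply_of_ne_of_ne <;> simp <;> omega
  have s3 : sgen n j ⟨k, by omega⟩ = ⟨k, by omega⟩ := by
    rw [sgen_of h0]; apply Equiv.swap_apply_of_ne_of_ne <;> simp <;> omega
  have s4 : sgen n j ⟨k+1, by omega⟩ = ⟨k+1, by omega⟩ := by
    rw [sgen_of h0]; apply Equiv.swap_apply_of_ne_of_ne <;> simp <;> omega
  simp only [s1, s2, s3, s4]
  split_ifs <;> ring

/-! JM elements -/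
def Tiop (n j : ℕ) : Module.End HR (MM n) :=
  if j + 1 < n then ti • (Top n j + algebraMap HR _ (1 - tt)) else 1

lemma Top_Tiop (n j : ℕ) : Top n j * Tiop n j = 1 := by
  by_cases h : j + 1 < n
  · simp only [Tiop, h, if_true]
    rw [mul_smul_comm, mul_add, Top_quad h, ← Algebra.commutes, ← Algebra.smul_def]
    rw [add_right_comm, ← add_smul, show tt - 1 + (1 - tt) = 0 by ring, zero_smul, zero_add,
      Algebra.algebraMap_eq_smul_one, smul_smul, ti_tt, one_smul]
  · simp [Tiop, h, Top]

lemma Tiop_Top (n j : ℕ) : Tiop n j * Top n j = 1 := by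
  have : Commute (Top n j) (Tiop n j) := by
    by_cases h : j + 1 < n
    · simp only [Tiop, h, if_true]
      apply Commute.smul_right
      apply Commute.add_right (Commute.refl _)
      exact (Algebra.commutes _ _).symm
    · simp [Tiop, h, Top]
  rw [← this.eq, Top_Tiop]

def Xop (n : ℕ) : ℕ → Module.End HR (MM n)
  | 0 => 1
  | j+1 => ti • (Top n j * Xop n j * Top n j)

def Xiop (n : ℕ) : ℕ → Module.End HR (MM n)
  | 0 => 1
  | j+1 => tt • (Tiop n j * Xiop n j * Tiop n j)

lemma Xop_Xiop (n j : ℕ) : Xop n j * Xiop n j = 1 := by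
  induction j with
  | zero => simp [Xop, Xiop]
  | succ j ih =>
    simp only [Xop, Xiop]
    rw [smul_mul_smul_comm, ti_tt, one_smul]
    calc _ = Top n j * Xop n j * (Top n j * Tiop n j) * Xiop n j * Tiop n j := by noncomm_ring
      _ = Top n j * (Xop n j * Xiop n j) * Tiop n j := by rw [Top_Tiop]; noncomm_ring
      _ = 1 := by rw [ih, mul_one, Top_Tiop]

lemma Xiop_Xop (n j : ℕ) : Xiop n j * Xop n j = 1 := by
  induction j with
  | zero => simp [Xop, Xiop]
  | succ j ih =>
    simp only [Xop, Xiop]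
    rw [smul_mul_smul_comm, tt_ti, one_smul]
    calc _ = Tiop n j * Xiop n j * (Tiop n j * Top n j) * Xop n j * Top n j := by noncomm_ring
      _ = Tiop n j * (Xiop n j * Xop n j) * Top n j := by rw [Tiop_Top]; noncomm_ring
      _ = 1 := by rw [ih, mul_one, Tiop_Top]

lemma comm_Xop {n : ℕ} (a : Module.End HR (MM n)) (j : ℕ) (h : ∀ k < j, Commute a (Top n k)) :
    Commute a (Xop n j) := by
  induction j with
  | zero => exact Commute.one_right _
  | succ j ih =>
    have h1 := ih fun k hk => h k (by omega)
    exact (((h j (by omega)).mul_right h1).mul_right (h j (by omega))).smul_right _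

lemma T_Xop_gt {n j k : ℕ} (hk : k + 1 < n) (h : j < k) : Commute (Top n k) (Xop n j) :=
  comm_Xop _ _ fun m hm => (Top_comm (by omega) hk).symm

lemma T_Xop_lt {n j k : ℕ} (hj : j < n) (h : k + 1 < j) : Commute (Top n k) (Xop n j) := by
  induction j with
  | zero => omega
  | succ j ih =>
    rcases Nat.lt_or_ge (k+1) j with h1 | h1
    · have h2 := ih (by omega) h1
      have h3 : Commute (Top n k) (Top n j) := Top_comm h1 hj
      exact ((h3.mul_right h2).mul_right h3).smul_right _
    · obtain rfl : j = k + 1 := by omega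
      have hb := Top_braid (n := n) (j := k) (by omega)
      have hc := (T_Xop_gt (n := n) (j := k) (k := k+1) (by omega) (by omega)).eq
      simp only [Xop, mul_smul_comm, smul_mul_assoc]
      apply Commute.smul_right
      apply Commute.smul_right
      generalize Top n k = a at *
      generalize Top n (k+1) = b at *
      generalize Xop n k = x at *
      show a * (b * (a * x * a) * b) = (b * (a * x * a) * b) * a
      calc _ = (a * b * a) * x * a * b := by noncomm_ring
        _ = b * a * (b * x) * a * b := by rw [hb]; noncomm_ring
        _ = b * a * x * (b * a * b) := by rw [hc]; noncomm_ring
        _ = _ := by rw [← hb]; noncomm_ring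

lemma Xop_comm {n : ℕ} (i j : ℕ) (hi : i < n) (hj : j < n) : Commute (Xop n i) (Xop n j) := by
  rcases lt_trichotomy i j with h | rfl | h
  · exact (comm_Xop _ _ fun k hk => (T_Xop_lt hj (by omega)).symm).symm
  · exact Commute.refl _
  · exact (comm_Xop _ _ fun k hk => (T_Xop_lt hi (by omega)).symm)

def gop (n : ℕ) : AGen n → Module.End HR (MM n)
  | AGen.T j => Top n j
  | AGen.X i => Xop n i
  | AGen.Xinv i => Xiop n i

def rho (n : ℕ) : H n →ₐ[HR] Module.End HR (MM n) :=
  RingQuot.liftAlgHom HR ⟨FreeAlgebra.lift HR (gop n), by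
    intro x y hxy
    cases hxy with
    | junk j h => simp [fT, gop, Top, h]
    | quad j h => simpa [fT, gop] using Top_quad h
    | braid j h => simpa [fT, gop] using Top_braid h
    | commT j k hjk hk => simpa [fT, gop] using Top_comm hjk hk
    | commX i i' => simpa [fX, gop] using (Xop_comm i i' i.2 i'.2).eq
    | XinvL i => simpa [fX, fXi, gop] using Xop_Xiop n i
    | XinvR i => simpa [fX, fXi, gop] using Xiop_Xop n i
    | TXT j h => simp [fX, fT, gop, Xop, smul_smul, tt_ti]
    | TXcomm j h i h1 h2 =>
      simp only [fX, fT, gop, map_mul, FreeAlgebra.lift_ι_apply]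
      rcases Nat.lt_or_ge i j with h3 | h3
      · exact (T_Xop_gt h h3).eq
      · exact (T_Xop_lt i.2 (by omega)).eq⟩

lemma rho_Tg (n j : ℕ) : rho n (Tg n j) = Top n j := by
  simp [rho, Tg, fT, gop]

/-! inversions -/
def invS (n : ℕ) (w : Equiv.Perm (Fin n)) : Finset (Fin n × Fin n) :=
  Finset.univ.filter fun p => p.1 < p.2 ∧ w p.2 < w p.1

def inv (n : ℕ) (w : Equiv.Perm (Fin n)) : ℕ := (invS n w).card

lemma inv_up {n j : ℕ} (h : j + 1 < n) (w : Equiv.Perm (Fin n))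
    (hw : w⁻¹ ⟨j, Nat.lt_of_succ_lt h⟩ < w⁻¹ ⟨j+1, h⟩) :
    inv n (sgen n j * w) = inv n w + 1 := by
  have : invS n (sgen n j * w) =
      insert (w⁻¹ ⟨j, Nat.lt_of_succ_lt h⟩, w⁻¹ ⟨j+1, h⟩) (invS n w) := by
    ext ⟨a, b⟩
    simp only [invS, Finset.mem_filter, Finset.mem_univ, true_and, Finset.mem_insert,
      Prod.mk.injEq, Equiv.Perm.mul_apply, Fin.lt_def, sgen_val h]
    rw [Equiv.Perm.eq_inv_iff_eq, Equiv.Perm.eq_inv_iff_eq, Fin.ext_iff, Fin.ext_iff]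
    simp only
    have h1 : ∀ x y, (x : Fin n) = w y → y = w⁻¹ x := fun x y e => by rw [e]; simp
    have hab : (w a : ℕ) = w b → a = b := fun e => w.injective (Fin.ext e)
    have ha : (w a : ℕ) = j → a = w⁻¹ ⟨j, Nat.lt_of_succ_lt h⟩ := fun e => h1 _ _ (Fin.ext e.symm)
    have ha' : (w a : ℕ) = j+1 → a = w⁻¹ ⟨j+1, h⟩ := fun e => h1 _ _ (Fin.ext e.symm)
    have hb : (w b : ℕ) = j → b = w⁻¹ ⟨j, Nat.lt_of_succ_lt h⟩ := fun e => h1 _ _ (Fin.ext e.symm)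
    have hb' : (w b : ℕ) = j+1 → b = w⁻¹ ⟨j+1, h⟩ := fun e => h1 _ _ (Fin.ext e.symm)
    rw [Fin.lt_def] at hw
    simp only [Fin.ext_iff] at ha ha' hb hb' hab
    generalize (w⁻¹ ⟨j, Nat.lt_of_succ_lt h⟩ : Fin n).val = x at *
    generalize (w⁻¹ ⟨j+1, h⟩ : Fin n).val = y at *
    generalize (w a).val = wa at *
    generalize (w b).val = wb at *
    clear h1
    split_ifs <;> omega
  rw [inv, this, Finset.card_insert_of_notMem, inv]
  simp [invS]

lemma inv_down {n j : ℕ} (h : j + 1 < n) (w : Equiv.Perm (Fin n))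
    (hw : w⁻¹ ⟨j+1, h⟩ < w⁻¹ ⟨j, Nat.lt_of_succ_lt h⟩) :
    inv n w = inv n (sgen n j * w) + 1 := by
  have := inv_up h (sgen n j * w) (by
    rw [mul_inv_rev, sgen_inv, sgen_of h]; simpa using hw)
  rwa [sgen_sq'] at this

lemma inv_cases {n j : ℕ} (h : j + 1 < n) (w : Equiv.Perm (Fin n)) :
    inv n (sgen n j * w) ≤ inv n w + 1 ∧ (inv n (sgen n j * w) = inv n w + 1 →
      w⁻¹ ⟨j, Nat.lt_of_succ_lt h⟩ < w⁻¹ ⟨j+1, h⟩) := by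
  have e : w⁻¹ ⟨j, Nat.lt_of_succ_lt h⟩ ≠ w⁻¹ ⟨j+1, h⟩ := by simp
  rcases lt_or_gt_of_ne e with h1 | h1
  · exact ⟨(inv_up h w h1).le, fun _ => h1⟩
  · have := inv_down h w h1
    exact ⟨by omega, fun _ => by omega⟩

lemma inv_one (n : ℕ) : inv n 1 = 0 := by
  rw [inv, Finset.card_eq_zero, invS, Finset.filter_eq_empty_iff]
  rintro ⟨a, b⟩ -
  simp only [Equiv.Perm.one_apply, not_and, not_lt]
  exact le_of_lt

lemma inv_inv (n : ℕ) (w : Equiv.Perm (Fin n)) : inv n w⁻¹ = inv n w := by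
  apply Finset.card_bij (fun p _ => (w⁻¹ p.2, w⁻¹ p.1))
  · rintro ⟨a, b⟩ h
    simpa [invS, and_comm] using h
  · rintro ⟨a, b⟩ h ⟨c, d⟩ h'
    simp only [Prod.mk.injEq, EmbeddingLike.apply_eq_iff_eq]; tauto
  · rintro ⟨a, b⟩ h
    exact ⟨(w b, w a), by simpa [invS, and_comm] using h, by simp⟩

lemma inv_word_mul (n : ℕ) (l : List ℕ) (hl : ∀ j ∈ l, j + 1 < n) (w) :
    inv n (wordProd n l * w) ≤ l.length + inv n w := by
  induction l with
  | nil => simp [wordProd]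
  | cons j l ih =>
    have := ih fun k hk => hl k (by simp [hk])
    have h2 := (inv_cases (hl j (by simp)) (wordProd n l * w)).1
    simp only [wordProd, List.map_cons, List.prod_cons, List.length_cons, mul_assoc] at *
    omega

lemma eq_one_of_asc (n : ℕ) (w : Equiv.Perm (Fin n))
    (h : ∀ j (h : j + 1 < n), w⁻¹ ⟨j, Nat.lt_of_succ_lt h⟩ < w⁻¹ ⟨j+1, h⟩) : w = 1 := by
  have h2 : StrictMono (w⁻¹ : Equiv.Perm (Fin n)) := by
    cases n with
    | zero => intro a; exact a.elim0
    | succ n =>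
      rw [Fin.strictMono_iff_lt_succ]
      intro i
      exact h i (by omega)
  have h3 := Subsingleton.elim (h2.orderIsoOfSurjective _ (Equiv.surjective _))
    (OrderIso.refl (Fin n))
  have h4 : w⁻¹ = 1 := by
    ext x
    have := congrArg (fun e => ((e x : Fin n) : ℕ)) h3
    simpa using this
  simpa using h4

lemma exists_word (n : ℕ) (w : Equiv.Perm (Fin n)) :
    ∃ l : List ℕ, (∀ j ∈ l, j + 1 < n) ∧ l.length = inv n w ∧ wordProd n l = w := by
  induction hk : inv n w generalizing w with
  | zero =>
    refine ⟨[], by simp, rfl, ?_⟩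
    symm
    apply eq_one_of_asc
    intro j h
    by_contra hc
    have e : w⁻¹ ⟨j, Nat.lt_of_succ_lt h⟩ ≠ w⁻¹ ⟨j+1, h⟩ := by simp
    have := inv_down h w (by omega)
    omega
  | succ k ih =>
    by_cases hd : ∃ j, ∃ h : j + 1 < n, w⁻¹ ⟨j+1, h⟩ < w⁻¹ ⟨j, Nat.lt_of_succ_lt h⟩
    · obtain ⟨j, h, hd⟩ := hd
      have := inv_down h w hd
      obtain ⟨l, h1, h2, h3⟩ := ih (sgen n j * w) (by omega)
      refine ⟨j :: l, by simpa using ⟨h, h1⟩, by simp [h2], ?_⟩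
      rw [wordProd, List.map_cons, List.prod_cons, ← wordProd, h3, sgen_sq']
    · push Not at hd
      have := eq_one_of_asc n w fun j h => lt_of_le_of_ne (hd j h) (by simp)
      rw [this, inv_one] at hk
      omega

lemma len_eq (n : ℕ) (w : Equiv.Perm (Fin n)) : len n w = inv n w := by
  apply le_antisymm
  · obtain ⟨l, h⟩ := exists_word n w
    exact Nat.sInf_le ⟨l, h⟩
  · apply le_csInf
    · obtain ⟨l, h⟩ := exists_word n w
      exact ⟨_, l, h⟩
    · rintro k ⟨l, h1, rfl, rfl⟩
      simpa [inv_one] using inv_word_mul n l h1 1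

lemma redWord_spec (n : ℕ) (w : Equiv.Perm (Fin n)) :
    (∀ j ∈ redWord n w, j + 1 < n) ∧ (redWord n w).length = inv n w ∧
      wordProd n (redWord n w) = w := by
  have h : ∃ l : List ℕ, (∀ j ∈ l, j + 1 < n) ∧ l.length = len n w ∧ wordProd n l = w := by
    rw [len_eq]; exact exists_word n w
  have := h.choose_spec
  rw [redWord, dif_pos h, ← len_eq]
  exact this

def dl (n : ℕ) (w : Equiv.Perm (Fin n)) : MM n := Pi.single w 1

lemma Top_dl {n j : ℕ} (h : j + 1 < n) (w : Equiv.Perm (Fin n))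
    (hw : w⁻¹ ⟨j, Nat.lt_of_succ_lt h⟩ < w⁻¹ ⟨j+1, h⟩) :
    Top n j (dl n w) = dl n (sgen n j * w) := by
  funext v
  rw [Top_apply h]
  have e : sgen n j * v = w ↔ v = sgen n j * w := by
    constructor
    · rintro rfl; rw [sgen_sq']
    · rintro rfl; rw [sgen_sq']
  simp only [dl, Pi.single_apply, e]
  by_cases h1 : v = sgen n j * w
  · subst h1
    have h2 : ¬ (sgen n j * w = w) := by
      intro h3
      have := inv_up h w hw
      rw [h3] at this; omega
    have h4 : ¬ ((sgen n j * w)⁻¹ ⟨j, Nat.lt_of_succ_lt h⟩ < (sgen n j * w)⁻¹ ⟨j+1, h⟩) := by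
      rw [mul_inv_rev, sgen_inv, sgen_of h]; simpa using hw.le
    rw [if_neg h4]; simp [h2]
  · by_cases h2 : v = w
    · subst h2; rw [if_pos hw]; simp [h1]
    · simp [h1, h2]

lemma TofWord_dl (n : ℕ) (l : List ℕ) (hl : ∀ j ∈ l, j + 1 < n) (w)
    (h : inv n (wordProd n l * w) = l.length + inv n w) :
    rho n (TofWord n l) (dl n w) = dl n (wordProd n l * w) := by
  induction l with
  | nil => simp [wordProd, TofWord]
  | cons j l ih =>
    have hl' : ∀ j ∈ l, j + 1 < n := fun k hk => hl k (by simp [hk])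
    have h1 := inv_word_mul n l hl' w
    have hj := hl j (by simp)
    have h2 := inv_cases hj (wordProd n l * w)
    simp only [wordProd, TofWord, List.map_cons, List.prod_cons, List.length_cons, mul_assoc, map_mul,
      Module.End.mul_apply, rho_Tg] at *
    rw [ih hl' (by omega)]
    exact Top_dl hj _ (h2.2 (by omega))

lemma Tw_dl (n : ℕ) (u w : Equiv.Perm (Fin n)) (h : inv n (u * w) = inv n u + inv n w) :
    rho n (Tw n u) (dl n w) = dl n (u * w) := by
  obtain ⟨h1, h2, h3⟩ := redWord_spec n u
  have := TofWord_dl n _ h1 w (by rw [h2, h3, h])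
  rwa [h3] at this

def phi (n : ℕ) : H n →ₗ[HR] MM n := (LinearMap.applyₗ (dl n 1)).comp (rho n).toLinearMap

lemma phi_apply (n : ℕ) (h : H n) : phi n h = rho n h (dl n 1) := rfl

lemma phi_mul (n : ℕ) (g h : H n) : phi n (g * h) = rho n g (phi n h) := by
  simp [phi_apply]

lemma phi_Tw (n : ℕ) (w) : phi n (Tw n w) = dl n w := by
  rw [phi_apply, Tw_dl _ _ _ (by simp [inv_one]), mul_one]

/-- injectivity of phi on the span of the T_w -/
lemma phi_inj (n : ℕ) (lam : Fin n → ℤ) (g : H n) (hg : g ∈ HparaM n lam) (h0 : phi n g = 0) :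
    g = 0 := by
  have hg' : g ∈ Submodule.span HR (Set.range (Tw n)) :=
    Submodule.span_mono (Set.image_subset_range _ _) hg
  rw [Submodule.mem_span_range_iff_exists_fun] at hg'
  obtain ⟨c, rfl⟩ := hg'
  have : c = 0 := by
    funext w
    have := congrFun h0 w
    simpa [phi_Tw, dl, Pi.single_apply] using this
  simp [this]

/-! units -/
lemma Tg_quad {n j : ℕ} (h : j + 1 < n) :
    Tg n j * Tg n j = (tt - 1) • Tg n j + algebraMap HR _ tt := by
  have := RingQuot.mkAlgHom_rel HR (ARel.quad j h)
  simpa [Tg] using this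

lemma Tg_unit {n j : ℕ} (h : j + 1 < n) : IsUnit (Tg n j) := by
  have h1 : Tg n j * (Tg n j + algebraMap HR _ (1 - tt)) = algebraMap HR _ tt := by
    rw [mul_add, Tg_quad h, ← Algebra.commutes, ← Algebra.smul_def]
    rw [add_right_comm, ← add_smul, show tt - 1 + (1 - tt) = 0 by ring, zero_smul, zero_add]
  have h2 : (Tg n j + algebraMap HR _ (1 - tt)) * Tg n j = algebraMap HR _ tt := by
    rw [← h1, mul_add, add_mul, Algebra.commutes]
  refine ⟨⟨Tg n j, ti • (Tg n j + algebraMap HR _ (1 - tt)), ?_, ?_⟩, rfl⟩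
  · rw [mul_smul_comm, h1, Algebra.algebraMap_eq_smul_one, smul_smul, ti_tt, one_smul]
  · rw [smul_mul_assoc, h2, Algebra.algebraMap_eq_smul_one, smul_smul, ti_tt, one_smul]

lemma TofWord_unit (n : ℕ) (l : List ℕ) (hl : ∀ j ∈ l, j + 1 < n) : IsUnit (TofWord n l) := by
  induction l with
  | nil => simp [TofWord]
  | cons j l ih =>
    have hl' : ∀ j ∈ l, j + 1 < n := fun k hk => hl k (by simp [hk])
    simpa [TofWord] using (Tg_unit (hl j (by simp))).mul (ih hl')

lemma Tw_unit (n : ℕ) (w) : IsUnit (Tw n w) := TofWord_unit n _ (redWord_spec n w).1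

lemma rho_inj {n : ℕ} {a : H n} (ha : IsUnit a) (f : MM n) (h : rho n a f = 0) : f = 0 := by
  have h1 := congrArg (rho n (Ring.inverse a)) h
  rw [← Module.End.mul_apply, ← map_mul, Ring.inverse_mul_cancel _ ha] at h1
  simpa using h1

lemma rho_Tg_inv {n j : ℕ} (h : j + 1 < n) : rho n (Ring.inverse (Tg n j)) = Tiop n j := by
  have h1 : rho n (Ring.inverse (Tg n j)) * Top n j = 1 := by
    rw [← rho_Tg, ← map_mul, Ring.inverse_mul_cancel _ (Tg_unit h), map_one]
  calc _ = rho n (Ring.inverse (Tg n j)) * (Top n j * Tiop n j) := by rw [Top_Tiop, mul_one]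
    _ = _ := by rw [← mul_assoc, h1, one_mul]

def cnt {n : ℕ} (A : Finset (Fin n)) (k : ℕ) : ℕ := (A.filter fun x : Fin n => (x : ℕ) < k).card

lemma cnt_succ {n : ℕ} (A : Finset (Fin n)) (a : ℕ) (h : a < n) :
    cnt A (a + 1) = cnt A a + if (⟨a, h⟩ : Fin n) ∈ A then 1 else 0 := by
  unfold cnt
  split_ifs with h1
  · have : (A.filter fun x : Fin n => (x : ℕ) < a + 1) = insert ⟨a, h⟩ (A.filter fun x : Fin n => (x : ℕ) < a) := by
      ext x
      simp only [Finset.mem_filter, Finset.mem_insert, Fin.ext_iff]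
      constructor
      · rintro ⟨h2, h3⟩
        by_cases h4 : (x : ℕ) = a
        · exact Or.inl h4
        · exact Or.inr ⟨h2, by omega⟩
      · rintro (h2 | h2)
        · exact ⟨by rwa [show x = ⟨a, h⟩ from Fin.ext h2], by omega⟩
        · exact ⟨h2.1, by omega⟩
    rw [this, Finset.card_insert_of_notMem (by simp)]
  · congr 1
    ext x
    simp only [Finset.mem_filter]
    constructor
    · rintro ⟨h2, h3⟩
      refine ⟨h2, ?_⟩
      by_contra h4
      exact h1 (by rwa [← show x = ⟨a, h⟩ from Fin.ext (by simp; omega)])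
    · rintro ⟨h2, h3⟩
      exact ⟨h2, by omega⟩

lemma cnt_s {n j k : ℕ} (h : j + 1 < n) (A : Finset (Fin n)) (hk : k ≠ j + 1) :
    cnt (A.image (sgen n j)) k = cnt A k := by
  unfold cnt
  rw [Finset.filter_image, Finset.card_image_of_injective _ (sgen n j).injective]
  congr 1
  apply Finset.filter_congr
  intro x _
  rw [sgen_val h]
  split_ifs <;> omega

lemma mem_s {n j : ℕ} (A : Finset (Fin n)) (x : Fin n) :
    x ∈ A.image (sgen n j) ↔ sgen n j x ∈ A := by
  rw [Finset.mem_image]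
  constructor
  · rintro ⟨y, hy, rfl⟩
    rwa [← Equiv.Perm.mul_apply, sgen_sq]
  · intro hx
    exact ⟨_, hx, by rw [← Equiv.Perm.mul_apply, sgen_sq]; rfl⟩

def dom {n : ℕ} (A E : Finset (Fin n)) : Prop := ∀ k, cnt E k ≤ cnt A k

lemma dom_step {n j : ℕ} (h : j + 1 < n) (A E : Finset (Fin n)) (hd : dom A E)
    (hE : (⟨j+1, h⟩ : Fin n) ∈ E → (⟨j, Nat.lt_of_succ_lt h⟩ : Fin n) ∈ E) :
    dom A (E.image (sgen n j)) ∧ dom (A.image (sgen n j)) (E.image (sgen n j)) := by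
  have s1 : sgen n j ⟨j, by omega⟩ = ⟨j+1, by omega⟩ := by rw [sgen_of h]; simp
  have key : ∀ B : Finset (Fin n), cnt (B.image (sgen n j)) (j+1) =
      cnt B j + if (⟨j+1, h⟩ : Fin n) ∈ B then 1 else 0 := by
    intro B
    rw [cnt_succ _ j (by omega), cnt_s h _ (by omega)]
    simp only [mem_s, s1]
  have a1 := cnt_succ A j (by omega)
  have a2 := cnt_succ A (j+1) h
  have e1 := cnt_succ E j (by omega)
  have e2 := cnt_succ E (j+1) h
  have d0 := hd j
  have d1 := hd (j+1)
  have d2 := hd (j+1+1)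
  constructor
  · intro k
    by_cases hk : k = j + 1
    · subst hk
      rw [key]
      split_ifs at * <;> first | omega | (exfalso; tauto)
    · rw [cnt_s h _ hk]; exact hd k
  · intro k
    by_cases hk : k = j + 1
    · subst hk
      rw [key, key]
      split_ifs at * <;> first | omega | (exfalso; tauto)
    · rw [cnt_s h _ hk, cnt_s h _ hk]; exact hd k

def img (n : ℕ) (w : Equiv.Perm (Fin n)) (e : ℕ) : Finset (Fin n) := (hwCol n e).image w

lemma mem_img {n : ℕ} (w : Equiv.Perm (Fin n)) (e : ℕ) (x) : x ∈ img n w e ↔ ((w⁻¹ x : Fin n) : ℕ) < e := by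
  simp only [img, Finset.mem_image, hwCol, Finset.mem_filter, Finset.mem_univ, true_and]
  constructor
  · rintro ⟨y, hy, rfl⟩; simpa using hy
  · intro h; exact ⟨_, h, by simp⟩

lemma img_mul {n : ℕ} (u w : Equiv.Perm (Fin n)) (e : ℕ) : img n (u * w) e = (img n w e).image u := by
  rw [img, img, Finset.image_image]; rfl

def supp {n : ℕ} (e : ℕ) (f : MM n) (E : Finset (Fin n)) : Prop := ∀ w, f w ≠ 0 → dom (img n w e) E

lemma supp_Tiop {n j e : ℕ} (h : j + 1 < n) (f : MM n) (E : Finset (Fin n)) (hs : supp e f E)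
    (hE : (⟨j+1, h⟩ : Fin n) ∈ E → (⟨j, Nat.lt_of_succ_lt h⟩ : Fin n) ∈ E) :
    supp e (Tiop n j f) (E.image (sgen n j)) := by
  intro w hw
  by_cases h1 : f w = 0
  · by_cases h2 : f (sgen n j * w) = 0
    · exfalso; apply hw
      simp [Tiop, h, Top_apply h, h1, h2]
    · have := (dom_step h _ _ (hs _ h2) hE).2
      rwa [← img_mul, sgen_sq'] at this
  · exact (dom_step h _ _ (hs _ h1) hE).1

lemma ring_inverse_mul {R : Type*} [Semiring R] {a b : R} (ha : IsUnit a) (hb : IsUnit b) :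
    Ring.inverse (a * b) = Ring.inverse b * Ring.inverse a := by
  obtain ⟨a, rfl⟩ := ha
  obtain ⟨b, rfl⟩ := hb
  rw [← Units.val_mul, Ring.inverse_unit, Ring.inverse_unit, Ring.inverse_unit, mul_inv_rev,
    Units.val_mul]

lemma supp_word {n : ℕ} (e : ℕ) (f : MM n) (hf : supp e f (hwCol n e)) (l : List ℕ)
    (hl : ∀ j ∈ l, j + 1 < n) (hr : inv n (wordProd n l) = l.length) :
    supp e (rho n (Ring.inverse (TofWord n l.reverse)) f) (img n (wordProd n l) e) := by
  induction l with
  | nil =>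
    have : img n 1 e = hwCol n e := by simp [img]
    simpa [wordProd, TofWord, this] using hf
  | cons j l ih =>
    have hl' : ∀ j ∈ l, j + 1 < n := fun k hk => hl k (by simp [hk])
    have h := hl j (by simp)
    have hw : wordProd n (j :: l) = sgen n j * wordProd n l := by simp [wordProd]
    have h1 := inv_word_mul n l hl' 1
    rw [mul_one, inv_one] at h1
    have h2 := inv_cases h (wordProd n l)
    rw [hw, List.length_cons] at hr
    have h3 := h2.2 (by omega)
    have hT : TofWord n (j :: l).reverse = TofWord n l.reverse * Tg n j := by simp [TofWord]
    rw [hT, ring_inverse_mul (TofWord_unit n _ (by simpa using hl')) (Tg_unit h), map_mul,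
      rho_Tg_inv h, hw, img_mul]
    apply supp_Tiop h _ _ (ih hl' (by omega))
    rw [mem_img, mem_img]
    rw [Fin.lt_def] at h3
    omega

lemma supp_inv {n : ℕ} (e : ℕ) (f : MM n) (hf : supp e f (hwCol n e)) (u : Equiv.Perm (Fin n)) :
    supp e (rho n (Ring.inverse (Tw n u⁻¹)) f) (img n u e) := by
  obtain ⟨h1, h2, h3⟩ := redWord_spec n u⁻¹
  have hw : wordProd n (redWord n u⁻¹).reverse = u := by
    have : ∀ l, wordProd n l.reverse = (wordProd n l)⁻¹ := by
      intro l
      rw [wordProd, wordProd, List.prod_inv_reverse, List.map_reverse, List.map_map]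
      congr 3
      funext j
      exact (sgen_inv n j).symm
    rw [this, h3, _root_.inv_inv]
  have := supp_word e f hf (redWord n u⁻¹).reverse (by simpa using h1) (by
    rw [hw, List.length_reverse, h2, HLHecke.inv_inv])
  rwa [hw, List.reverse_reverse] at this

lemma stab_iff {n e : ℕ} {w : Equiv.Perm (Fin n)} (h : wAct n w (varpi n e) = varpi n e) (x : Fin n) :
    ((w x : Fin n) : ℕ) < e ↔ (x : ℕ) < e := by
  have := congrFun h (w x)
  have e : w⁻¹ (w x) = x := by simp
  simp only [wAct, varpi, e] at this
  split_ifs at this <;> tauto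

lemma stab_img {n e : ℕ} {w : Equiv.Perm (Fin n)} (h : wAct n w (varpi n e) = varpi n e) :
    img n w e = hwCol n e := by
  ext x
  rw [mem_img]
  have := stab_iff h (w⁻¹ x)
  have e : w (w⁻¹ x) = x := by simp
  rw [e] at this
  simpa [hwCol] using this.symm

lemma supp_para {n e : ℕ} (g : H n) (hg : g ∈ HparaM n (varpi n e)) : supp e (phi n g) (hwCol n e) := by
  induction hg using Submodule.span_induction with
  | mem x hx =>
    obtain ⟨y, hy, rfl⟩ := hx
    intro w hw
    rw [phi_Tw] at hw
    have : w = y := by by_contra h; exact hw (by simp [dl, h])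
    subst this
    rw [stab_img hy]
    intro k; exact le_rfl
  | zero => intro w hw; simp at hw
  | add x y _ _ hx hy =>
    intro w hw
    by_cases h1 : phi n x w = 0
    · apply hy w
      intro h2; apply hw; simp [h1, h2]
    · exact hx w h1
  | smul a x _ hx =>
    intro w hw
    apply hx w
    intro h2; apply hw; simp [h2]

/-! columns -/
lemma colPerm_lt {n : ℕ} (C : Finset (Fin n)) (x : Fin n) (h : (x : ℕ) < C.card) :
    colPerm n C x = C.orderEmbOfFin rfl ⟨x, h⟩ := by
  have : finSumFinEquiv.symm (finCongr ((Nat.add_sub_cancel' (col_card_le n C)).symm) x) =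
      Sum.inl (⟨x, h⟩ : Fin C.card) := by
    rw [Equiv.symm_apply_eq]; ext; simp
  unfold colPerm
  simp only [Equiv.trans_apply]
  rw [this]
  rfl

lemma colPerm_ge {n : ℕ} (C : Finset (Fin n)) (x : Fin n) (h : C.card ≤ (x : ℕ)) :
    colPerm n C x = Cᶜ.orderEmbOfFin (by simp [Finset.card_compl])
      (⟨x - C.card, by omega⟩ : Fin (n - C.card)) := by
  have : finSumFinEquiv.symm (finCongr ((Nat.add_sub_cancel' (col_card_le n C)).symm) x) =
      Sum.inr (⟨x - C.card, by omega⟩ : Fin (n - C.card)) := by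
    rw [Equiv.symm_apply_eq]; ext; simp; omega
  unfold colPerm
  simp only [Equiv.trans_apply]
  rw [this]
  rfl

lemma colPerm_mono {n : ℕ} (C : Finset (Fin n)) (x y : Fin n) (h : x < y)
    (hb : (x : ℕ) < C.card ↔ (y : ℕ) < C.card) : colPerm n C x < colPerm n C y := by
  rw [Fin.lt_def] at h
  by_cases hx : (x : ℕ) < C.card
  · rw [colPerm_lt C x hx, colPerm_lt C y (hb.1 hx)]
    apply (C.orderEmbOfFin rfl).strictMono
    exact h
  · have hy : ¬ (y : ℕ) < C.card := fun h => hx (hb.2 h)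
    rw [colPerm_ge C x (by omega), colPerm_ge C y (by omega)]
    apply (Cᶜ.orderEmbOfFin _).strictMono
    rw [Fin.lt_def]
    simp only
    omega

lemma colPerm_img {n : ℕ} (C : Finset (Fin n)) : img n (colPerm n C) C.card = C := by
  apply Finset.eq_of_subset_of_card_le
  · intro x hx
    rw [mem_img] at hx
    have := colPerm_lt C _ hx
    have e : colPerm n C ((colPerm n C)⁻¹ x) = x := by simp
    rw [e] at this
    rw [this]
    exact Finset.orderEmbOfFin_mem _ _ _
  · rw [img, Finset.card_image_of_injective _ (colPerm n C).injective]
    have : hwCol n C.card = Finset.univ.image (Fin.castLE (col_card_le n C)) := by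
      ext x
      simp only [hwCol, Finset.mem_filter, Finset.mem_univ, true_and, Finset.mem_image]
      constructor
      · intro h; exact ⟨⟨x, h⟩, rfl⟩
      · rintro ⟨y, rfl⟩; exact y.2
    rw [this, Finset.card_image_of_injective _ (Fin.castLE_injective _)]
    simp

lemma mem_invS {n : ℕ} (w : Equiv.Perm (Fin n)) (a b : Fin n) :
    (a, b) ∈ invS n w ↔ a < b ∧ w b < w a := by simp [invS]

lemma inv_add {n : ℕ} (l : ℕ) (u y : Equiv.Perm (Fin n))
    (hu : ∀ a b : Fin n, a < b → ((a : ℕ) < l ↔ (b : ℕ) < l) → u a < u b)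
    (hy : ∀ a : Fin n, ((y a : Fin n) : ℕ) < l ↔ (a : ℕ) < l) :
    inv n (u * y) = inv n u + inv n y := by
  have h1 : invS n (u * y) = (invS n u).map ((y⁻¹).prodCongr y⁻¹).toEmbedding ∪ invS n y := by
    ext ⟨a, b⟩
    rw [Finset.mem_union, Finset.mem_map_equiv]
    have e : ((y⁻¹).prodCongr y⁻¹).symm (a, b) = (y a, y b) := rfl
    rw [e, mem_invS, mem_invS, mem_invS, Equiv.Perm.mul_apply, Equiv.Perm.mul_apply]
    have ha := hy a
    have hb := hy b
    have m1 := hu (y a) (y b)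
    have m2 := hu (y b) (y a)
    have i1 : a = b ↔ y a = y b := by simp
    have i2 : y a = y b ↔ u (y a) = u (y b) := by simp
    clear hu hy e
    simp only [Fin.lt_def, Fin.ext_iff] at ha hb m1 m2 i1 i2 ⊢
    generalize (u (y a)).val = p at *
    generalize (u (y b)).val = q at *
    generalize (y a).val = c at *
    generalize (y b).val = d at *
    by_cases k1 : c < l <;> by_cases k2 : d < l <;> simp only [k1, k2, true_iff, false_iff, iff_true, iff_false, iff_self, forall_const, not_true, IsEmpty.forall_iff] at ha hb m1 m2 <;> omega
  have h2 : Disjoint ((invS n u).map ((y⁻¹).prodCongr y⁻¹).toEmbedding) (invS n y) := by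
    rw [Finset.disjoint_left]
    rintro ⟨a, b⟩ h3 h4
    rw [Finset.mem_map_equiv] at h3
    have e : ((y⁻¹).prodCongr y⁻¹).symm (a, b) = (y a, y b) := rfl
    rw [e] at h3
    simp only [invS, Finset.mem_filter, Finset.mem_univ, true_and] at h3 h4
    exact absurd h3.1 (not_lt_of_gt h4.2)
  rw [inv, h1, Finset.card_union_of_disjoint h2, Finset.card_map, inv, inv]

lemma coset_supp {n : ℕ} (F : Finset (Fin n)) (g : H n) (hg : g ∈ HparaM n (varpi n F.card)) :
    ∀ w, phi n (Tw n (colPerm n F) * g) w ≠ 0 → img n w F.card = F := by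
  induction hg using Submodule.span_induction with
  | mem x hx =>
    obtain ⟨y, hy, rfl⟩ := hx
    intro w hw
    rw [phi_mul, phi_Tw, Tw_dl _ _ _ (inv_add F.card _ _ (colPerm_mono F) (stab_iff hy))] at hw
    have : w = colPerm n F * y := by by_contra h; exact hw (by simp [dl, h])
    subst this
    rw [img_mul, stab_img hy]
    exact colPerm_img F
  | zero => intro w hw; simp at hw
  | add x y _ _ hx hy =>
    intro w hw
    by_cases h1 : phi n (Tw n (colPerm n F) * x) w = 0
    · apply hy w
      intro h2; apply hw; simp [mul_add, h1, h2]
    · exact hx w h1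
  | smul a x _ hx =>
    intro w hw
    apply hx w
    intro h2; apply hw; simp [h2]

lemma paraCoeff_zero {n : ℕ} (h : H n) (C : Finset (Fin n))
    (hz : ∀ w, img n w C.card = C → phi n h w = 0) : paraCoeff n C.card h C = 0 := by
  unfold paraCoeff
  split_ifs with hex
  · have hs := hex.choose_spec
    generalize hex.choose = g at hs
    obtain ⟨h1, h2⟩ := hs
    have hC : C ∈ colFinset n C.card := by simp [colFinset]
    apply phi_inj n _ _ (h1 C rfl)
    apply rho_inj (Tw_unit n (colPerm n C))
    rw [← phi_mul]
    funext w
    by_contra hw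
    have hw1 := coset_supp C _ (h1 C rfl) w hw
    have hw2 := hz w hw1
    rw [h2, map_sum, Finset.sum_apply, Finset.sum_eq_single_of_mem C hC] at hw2
    · exact hw hw2
    · intro F hF hFC
      by_contra hc
      have hF' : F.card = C.card := by simpa [colFinset] using hF
      have := coset_supp F (g F) (by rw [hF']; exact h1 F hF') w hc
      rw [hF', hw1] at this
      exact hFC this.symm
  · rfl

lemma paraCoeff_mem {n : ℕ} (h : H n) (C : Finset (Fin n)) :
    paraCoeff n C.card h C ∈ HparaM n (varpi n C.card) := by
  unfold paraCoeff
  split_ifs with hex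
  · exact hex.choose_spec.1 C rfl
  · exact Submodule.zero_mem _

lemma Psi_form {n : ℕ} (C : Finset (Fin n)) (S : List (Finset (Fin n))) :
    ∃ g ∈ HparaM n (varpi n C.card), Psi n (C :: S) =
      tpow n (len n (colPerm n C)) * Ring.inverse (Tw n (colPerm n C)⁻¹) * g := by
  cases S with
  | nil =>
    refine ⟨onePara n (varpi n C.card), ?_, by rw [Psi]⟩
    apply Submodule.sum_mem
    intro w hw
    apply Submodule.subset_span
    exact ⟨w, by simpa [stabFinset] using hw, rfl⟩
  | cons E S =>
    exact ⟨_, paraCoeff_mem (Psi n (E :: S)) C, by rw [Psi]; simp⟩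

lemma Psi_supp {n : ℕ} (C : Finset (Fin n)) (S : List (Finset (Fin n))) :
    supp C.card (phi n (Psi n (C :: S))) C := by
  obtain ⟨g, hg, h⟩ := Psi_form C S
  have h1 := supp_inv _ _ (supp_para g hg) (colPerm n C)
  rw [colPerm_img] at h1
  intro w hw
  apply h1 w
  intro h2
  apply hw
  rw [h, mul_assoc, tpow, ← Algebra.smul_def, map_smul, phi_mul, Pi.smul_apply, h2, smul_zero]

lemma nth_eq {n : ℕ} (C : Finset (Fin n)) (k : ℕ) (hk : k < C.card) :
    nth n C k = (C.orderEmbOfFin rfl ⟨k, hk⟩ : Fin n) := by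
  rw [nth, Finset.orderEmbOfFin_apply, List.getD_eq_getElem _ _ (by simpa using hk)]
  simp

lemma nth_cnt {n : ℕ} (C : Finset (Fin n)) (k : ℕ) (hk : k < C.card) :
    k + 1 ≤ cnt C (nth n C k + 1) := by
  rw [nth_eq C k hk]
  calc k + 1 = (Finset.Iic (⟨k, hk⟩ : Fin C.card)).card := by simp
    _ = ((Finset.Iic (⟨k, hk⟩ : Fin C.card)).map (C.orderEmbOfFin rfl).toEmbedding).card := by
      rw [Finset.card_map]
    _ ≤ _ := by
      apply Finset.card_le_card
      intro x hx
      obtain ⟨i, hi, rfl⟩ := Finset.mem_map.1 hx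
      rw [Finset.mem_filter]
      refine ⟨Finset.orderEmbOfFin_mem _ _ _, ?_⟩
      have : C.orderEmbOfFin rfl i ≤ C.orderEmbOfFin rfl ⟨k, hk⟩ :=
        (C.orderEmbOfFin rfl).monotone (by simpa using hi)
      exact Nat.lt_succ_of_le this

lemma nth_le {n : ℕ} (C : Finset (Fin n)) (k m : ℕ) (hk : k < C.card) (h : k + 1 ≤ cnt C (m + 1)) :
    nth n C k ≤ m := by
  by_contra hc
  rw [nth_eq C k hk] at hc
  have : cnt C (m+1) ≤ k := by
    calc cnt C (m+1) ≤ ((Finset.Iio (⟨k, hk⟩ : Fin C.card)).map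
          (C.orderEmbOfFin rfl).toEmbedding).card := by
          apply Finset.card_le_card
          intro x hx
          rw [Finset.mem_filter] at hx
          have : x ∈ Set.range (C.orderEmbOfFin rfl) := by
            rw [Finset.range_orderEmbOfFin]; exact hx.1
          obtain ⟨i, rfl⟩ := this
          rw [Finset.mem_map]
          refine ⟨i, ?_, rfl⟩
          rw [Finset.mem_Iio]
          by_contra h3
          have : C.orderEmbOfFin rfl ⟨k, hk⟩ ≤ C.orderEmbOfFin rfl i :=
            (C.orderEmbOfFin rfl).monotone (not_lt.1 h3)
          rw [Fin.le_def] at this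
          omega
      _ = k := by rw [Finset.card_map]; simp
  omega

lemma pairSS_of_dom {n : ℕ} (F E : Finset (Fin n)) (h : dom F E) (hc : E.card ≤ F.card) :
    pairSS n F E := by
  intro k hk
  apply nth_le _ _ _ (by omega)
  exact (nth_cnt E k hk).trans (h _)

/-- if `T = C_r ⊗ … ⊗ C₁` (leftmost column first, column lengths
`1 ≤ ℓ₁ ≤ … ≤ ℓ_r ≤ n`) is not semistandard, then `Ψ_T = 0`. -/
theorem stmt10 (n : ℕ) (hn : 1 ≤ n) (L : List (Finset (Fin n))) (hne : L ≠ [])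
    (hcards : L.Chain' fun A B => B.card ≤ A.card)
    (hpos : ∀ C ∈ L, 1 ≤ C.card)
    (hns : ¬ isSSYT n L) :
    Psi n L = 0 := by
  clear hne hpos hn
  induction L with
  | nil => exact absurd List.isChain_nil hns
  | cons C S ih =>
    cases S with
    | nil => exact absurd (List.isChain_singleton _) hns
    | cons E S =>
      have hc := List.isChain_cons_cons.1 hcards
      have hz : paraCoeff n C.card (Psi n (E :: S)) C = 0 := by
        apply paraCoeff_zero
        intro w hw
        by_cases h1 : isSSYT n (E :: S)
        · have h2 : ¬ pairSS n C E := fun h => hns (List.isChain_cons_cons.2 ⟨h, h1⟩)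
          by_contra h3
          apply h2
          apply pairSS_of_dom _ _ _ hc.1
          intro k
          refine (Psi_supp E S w h3 k).trans ?_
          apply Finset.card_le_card
          apply Finset.filter_subset_filter
          intro x hx
          rw [← hw, mem_img]
          rw [mem_img] at hx
          exact lt_of_lt_of_le hx hc.1
        · rw [ih hc.2 h1]; simp
      rw [Psi, hz, mul_zero]
      simp

end HLHecke
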